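/- The definite integral ∫₀¹ log₂( 1/(4·sin²(πφ/2)) − 1/6 ) dφ equals log₂((2+√3)/6). -/

import Mathlib

open Real MeasureTheory

lemma aux_full : ∫ θ in (0:ℝ)..(2*π), Real.log (2 + Real.cos θ) = 2*π * Real.log ((2 + √3)/2) := by
  have h3 : √3 ^ 2 = 3 := Real.sq_sqrt (by norm_num)
  have h3p : 0 ≤ √3 := Real.sqrt_nonneg 3
  have key := circleAverage_log_norm_add_const_eq_posLog (a := ((2 + √3 : ℝ) : ℂ))
  have hn : ‖((2 + √3 : ℝ) : ℂ)‖ = 2 + √3 := by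
    rw [Complex.norm_real, Real.norm_of_nonneg (by positivity)]
  rw [hn, Real.posLog_eq_log (by rw [abs_of_nonneg (by positivity)]; linarith), Real.circleAverage_def] at key
  have hpt : ∀ θ : ℝ, Real.log ‖circleMap 0 1 θ + ((2 + √3 : ℝ) : ℂ)‖
      = (1/2) * (Real.log (2 + Real.cos θ) + Real.log (2 * (2 + √3))) := by
    intro θ
    have hc := Real.neg_one_le_cos θ
    have hsq : ‖circleMap 0 1 θ + ((2 + √3 : ℝ) : ℂ)‖ ^ 2 = (2 + Real.cos θ) * (2 * (2 + √3)) := by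
      rw [← Complex.normSq_eq_norm_sq, Complex.normSq_apply]
      simp only [circleMap, Complex.ofReal_one, one_mul, zero_add, Complex.add_re, Complex.add_im,
        Complex.exp_ofReal_mul_I_re, Complex.exp_ofReal_mul_I_im, Complex.ofReal_re, Complex.ofReal_im]
      have := Real.sin_sq_add_cos_sq θ
      linear_combination this + h3
    have := congrArg Real.log hsq
    rw [Real.log_pow, Real.log_mul (by linarith) (by positivity)] at this
    rw [Nat.cast_ofNat] at this
    linarith
  have hint : IntervalIntegrable (fun θ : ℝ => Real.log (2 + Real.cos θ)) volume 0 (2*π) := by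
    apply Continuous.intervalIntegrable
    apply Continuous.log (by fun_prop)
    intro x; have := Real.neg_one_le_cos x; linarith
  simp only [hpt] at key
  rw [intervalIntegral.integral_const_mul, intervalIntegral.integral_add hint (by simp),
    intervalIntegral.integral_const, smul_eq_mul, smul_eq_mul,
    Real.log_mul (by norm_num) (by positivity)] at key
  rw [Real.log_div (by positivity) (by norm_num)]
  have hp := Real.pi_pos
  field_simp at key
  linarith

lemma aux_half : ∫ θ in (0:ℝ)..π, Real.log (2 + Real.cos θ) = π * Real.log ((2 + √3)/2) := by
  have hint : ∀ a b, IntervalIntegrable (fun θ : ℝ => Real.log (2 + Real.cos θ)) volume a b := by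
    intro a b
    apply Continuous.intervalIntegrable
    apply Continuous.log (by fun_prop)
    intro x; have := Real.neg_one_le_cos x; linarith
  have h1 := intervalIntegral.integral_add_adjacent_intervals (hint 0 π) (hint π (2*π))
  have h2 := intervalIntegral.integral_comp_sub_left (a := 0) (b := π)
    (fun θ : ℝ => Real.log (2 + Real.cos θ)) (2*π)
  simp only [Real.cos_two_pi_sub, sub_zero] at h2
  rw [show 2*π - π = π by ring] at h2
  rw [aux_full, ← h2] at h1
  linarith

lemma aux_quarter : ∫ x in (0:ℝ)..(π/2), Real.log (2 + Real.cos (2*x)) = π/2 * Real.log ((2 + √3)/2) := by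
  have := intervalIntegral.integral_comp_mul_left (a := 0) (b := π/2)
    (fun θ : ℝ => Real.log (2 + Real.cos θ)) (two_ne_zero)
  rw [this, mul_zero, show 2*(π/2) = π by ring, aux_half, smul_eq_mul]
  ring

lemma aux_main : ∫ x in (0:ℝ)..(π/2), Real.log (1 / (4 * Real.sin x ^ 2) - 1 / 6)
    = π/2 * Real.log ((2 + √3)/6) := by
  have hint : IntervalIntegrable (fun θ : ℝ => Real.log (2 + Real.cos (2*θ))) volume 0 (π/2) := by
    apply Continuous.intervalIntegrable
    apply Continuous.log (by fun_prop)
    intro x; have := Real.neg_one_le_cos (2*x); linarith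
  have hs : IntervalIntegrable (fun θ : ℝ => Real.log (Real.sin θ)) volume 0 (π/2) :=
    intervalIntegrable_log_sin
  have hcongr : ∫ x in (0:ℝ)..(π/2), Real.log (1 / (4 * Real.sin x ^ 2) - 1 / 6)
      = ∫ x in (0:ℝ)..(π/2), ((Real.log (2 + Real.cos (2*x)) - Real.log 12) - 2 * Real.log (Real.sin x)) := by
    apply intervalIntegral.integral_congr_ae
    refine Filter.Eventually.of_forall fun x hx => ?_
    have hp := Real.pi_pos
    rw [Set.uIoc_of_le (by positivity)] at hx
    have hsin : 0 < Real.sin x := Real.sin_pos_of_pos_of_lt_pi hx.1 (by linarith [hx.2])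
    have hc := Real.neg_one_le_cos (2*x)
    have e : 1 / (4 * Real.sin x ^ 2) - 1 / 6 = (2 + Real.cos (2*x)) / 12 / Real.sin x ^ 2 := by
      rw [Real.cos_two_mul, Real.cos_sq']
      field_simp
      ring
    rw [e, Real.log_div (by apply ne_of_gt; apply div_pos <;> linarith) (by positivity), Real.log_div (by linarith) (by norm_num),
      Real.log_pow]
    push_cast; ring
  rw [hcongr, intervalIntegral.integral_sub (hint.sub (by simp)) (hs.const_mul 2),
    intervalIntegral.integral_sub hint (by simp), intervalIntegral.integral_const_mul,
    integral_log_sin_zero_pi_div_two, aux_quarter, intervalIntegral.integral_const, smul_eq_mul,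
    Real.log_div (by positivity) (by norm_num), Real.log_div (by positivity) (by norm_num),
    show (12:ℝ) = 2 * 6 by norm_num, Real.log_mul (by norm_num) (by norm_num)]
  ring

/-- `∫₀¹ log₂(1/(4 sin²(πφ/2)) − 1/6) dφ = log₂((2+√3)/6)`. -/
theorem stmt6 :
    ∫ φ in (0:ℝ)..1,
        Real.logb 2 (1 / (4 * Real.sin (Real.pi * φ / 2) ^ 2) - 1 / 6)
      = Real.logb 2 ((2 + Real.sqrt 3) / 6) := by
  have hp := Real.pi_pos
  have h := intervalIntegral.integral_comp_mul_left (a := 0) (b := 1)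
    (fun x : ℝ => Real.log (1 / (4 * Real.sin x ^ 2) - 1 / 6)) (c := π/2) (by positivity)
  rw [mul_zero, mul_one, aux_main, smul_eq_mul, inv_mul_cancel_left₀ (by positivity)] at h
  simp only [Real.logb]
  rw [intervalIntegral.integral_div, ← h]
  simp only [mul_div_right_comm]
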